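/- There exists a constant c > 0 such that for every point (λ, λ⋆) ∈ (1/25)ℒ with λ not a real number, one has |Im(λ)| · |Im(λ⋆)| ≥ c. -/

import Mathlib

open Complex MeasureTheory Real

noncomputable section

/-- ζ = exp(2πi/5), a primitive fifth root of unity. -/
def ζ₅ : ℂ := Complex.exp (2 * Real.pi * Complex.I / 5)

/-- Integer combination a + b z + c z² + d z³. -/
def comb (a b c d : ℤ) (z : ℂ) : ℂ := a + b * z + c * z ^ 2 + d * z ^ 3

/-- The lattice ℒ = σ((1−ζ)ℤ[ζ]) ⊆ ℂ × ℂ ≅ ℝ⁴, where σ = (σ₁, σ₂) is the Minkowski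
embedding, σ₁(ζ) = ζ and σ₂(ζ) = ζ². -/
def PenLat : Set (ℂ × ℂ) :=
  { p | ∃ a b c d : ℤ,
      p = ((1 - ζ₅) * comb a b c d ζ₅, (1 - ζ₅ ^ 2) * comb a b c d (ζ₅ ^ 2)) }

/-- The standard real inner product on ℂ ≅ ℝ². -/
def rdot (z w : ℂ) : ℝ := z.re * w.re + z.im * w.im

/-- The dual lattice ℒ* with respect to the standard inner product on ℝ⁴ = ℂ × ℂ. -/
def dualLat : Set (ℂ × ℂ) :=
  { ξ | ∀ ℓ ∈ PenLat, ∃ k : ℤ, rdot ξ.1 ℓ.1 + rdot ξ.2 ℓ.2 = (k : ℝ) }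

/-- τ = (1+√5)/2, the golden ratio. -/
def τ₀ : ℝ := (1 + Real.sqrt 5) / 2

/-- P, the convex hull of the fifth roots of unity. -/
def Pent : Set ℂ := convexHull ℝ {1, ζ₅, ζ₅ ^ 2, ζ₅ ^ 3, ζ₅ ^ 4}

/-- The windows W_{m,ω} for m = 1, 2, 3, 4. -/
def Window (m : ℕ) (ω : ℂ) : Set ℂ :=
  match m with
  | 1 => (fun z => z - 1 + ω) '' Pent
  | 2 => (fun z => -(τ₀ : ℂ) * z - 2 + ω) '' Pent
  | 3 => (fun z => (τ₀ : ℂ) * z - 3 + ω) '' Pent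
  | 4 => (fun z => -z - 4 + ω) '' Pent
  | _ => ∅

/-- The Fourier transform of the indicator function of a set A ⊆ ℂ ≅ ℝ². -/
def ftInd (A : Set ℂ) (y : ℂ) : ℂ :=
  ∫ x in A, Complex.exp (-(2 * Real.pi * Complex.I) * (rdot x y))

/-- The norm form of `ℤ[τ]` is anisotropic. -/
lemma golden_form_ne_zero {m n : ℤ} (h : m ≠ 0 ∨ n ≠ 0) : m ^ 2 - m * n - n ^ 2 ≠ 0 := by
  intro h0
  have hn : n ≠ 0 := by
    rintro rfl
    simp_all
  have hn' : (n : ℝ) ≠ 0 := by exact_mod_cast hn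
  have h0' : (m : ℝ) ^ 2 - m * n - n ^ 2 = 0 := by exact_mod_cast h0
  have hsq : ((2 * m - n) / n : ℝ) ^ 2 = 5 := by
    field_simp
    linear_combination 4 * h0'
  refine (by norm_num : Nat.Prime 5).irrational_sqrt ⟨|(2 * m - n) / n|, ?_⟩
  push_cast
  rw [← hsq, Real.sqrt_sq_eq_abs]

lemma ζ₅_eq : ζ₅ = ⟨Real.cos (2 * (π / 5)), Real.sin (2 * (π / 5))⟩ := by
  have h : (2 * π * Complex.I / 5 : ℂ) = ((2 * (π / 5) : ℝ) : ℂ) * Complex.I := by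
    push_cast
    ring
  rw [ζ₅, h]
  apply Complex.ext
  · exact Complex.exp_ofReal_mul_I_re _
  · exact Complex.exp_ofReal_mul_I_im _

lemma ζ₅_re : ζ₅.re = (√5 - 1) / 4 := by
  rw [ζ₅_eq, Real.cos_two_mul, Real.cos_pi_div_five]
  linear_combination (1 / 8) * Real.sq_sqrt (show (0 : ℝ) ≤ 5 by norm_num)

lemma ζ₅_re_pos : 0 < ζ₅.re := by
  rw [ζ₅_re]
  have : 1 < √5 := Real.lt_sqrt_of_sq_lt (by norm_num)
  linarith

lemma ζ₅_im_pos : 0 < ζ₅.im := by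
  rw [ζ₅_eq]
  exact Real.sin_pos_of_pos_of_lt_pi (by positivity) (by linarith [Real.pi_pos])

lemma ζ₅_re_quadratic : 4 * ζ₅.re ^ 2 + 2 * ζ₅.re - 1 = 0 := by
  rw [ζ₅_re]
  linear_combination (1 / 4) * Real.sq_sqrt (show (0 : ℝ) ≤ 5 by norm_num)

lemma ζ₅_re_sq_add_im_sq : ζ₅.re ^ 2 + ζ₅.im ^ 2 = 1 := by
  rw [ζ₅_eq]
  exact Real.cos_sq_add_sin_sq _

lemma ζ₅_pow_five : ζ₅ ^ 5 = 1 := by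
  rw [ζ₅, ← Complex.exp_nat_mul, ← Complex.exp_two_pi_mul_I]
  congr 1
  push_cast
  ring

lemma ζ₅_mul_conj : ζ₅ * (starRingEnd ℂ) ζ₅ = 1 := by
  rw [Complex.mul_conj, Complex.normSq_apply, ← sq, ← sq, ζ₅_re_sq_add_im_sq, Complex.ofReal_one]

lemma ζ₅_pow_four : ζ₅ ^ 4 = (starRingEnd ℂ) ζ₅ := by
  linear_combination (starRingEnd ℂ) ζ₅ * ζ₅_pow_five - ζ₅ ^ 4 * ζ₅_mul_conj

lemma ζ₅_pow_three : ζ₅ ^ 3 = (starRingEnd ℂ) (ζ₅ ^ 2) := by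
  rw [map_pow, ← ζ₅_pow_four]
  linear_combination -ζ₅ ^ 3 * ζ₅_pow_five

lemma ζ₅_sq_im : (ζ₅ ^ 2).im = 2 * ζ₅.re * ζ₅.im := by
  rw [sq, Complex.mul_im]
  ring

/-- Imaginary part of an integer combination of `ζ₅, ζ₅², ζ₅³, ζ₅⁴`. -/
lemma im_fifth_root_comb (k₀ k₁ k₂ k₃ k₄ : ℤ) :
    (k₀ + k₁ * ζ₅ + k₂ * ζ₅ ^ 2 + k₃ * ζ₅ ^ 3 + k₄ * ζ₅ ^ 4 : ℂ).im =
      (k₁ - k₄) * ζ₅.im + (k₂ - k₃) * (ζ₅ ^ 2).im := by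
  rw [ζ₅_pow_four, ζ₅_pow_three]
  simp only [Complex.add_im, Complex.mul_im, Complex.intCast_re, Complex.intCast_im, Complex.conj_im]
  ring

lemma im_lattice_fst (a b c d : ℤ) :
    ((1 - ζ₅) * comb a b c d ζ₅).im =
      (b - a + d) * ζ₅.im + (2 * c - b - d) * (ζ₅ ^ 2).im := by
  have h : (1 - ζ₅) * comb a b c d ζ₅ = (a : ℤ) + (b - a : ℤ) * ζ₅ + (c - b : ℤ) * ζ₅ ^ 2 +
      (d - c : ℤ) * ζ₅ ^ 3 + (-d : ℤ) * ζ₅ ^ 4 := by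
    rw [comb]
    push_cast
    ring
  rw [h, im_fifth_root_comb]
  push_cast
  ring

lemma im_lattice_snd (a b c d : ℤ) :
    ((1 - ζ₅ ^ 2) * comb a b c d (ζ₅ ^ 2)).im =
      (b - a + d) * (ζ₅ ^ 2).im - (2 * c - b - d) * ζ₅.im := by
  have h : (1 - ζ₅ ^ 2) * comb a b c d (ζ₅ ^ 2) = (a : ℤ) + (d - c : ℤ) * ζ₅ +
      (b - a : ℤ) * ζ₅ ^ 2 + (-d : ℤ) * ζ₅ ^ 3 + (c - b : ℤ) * ζ₅ ^ 4 := by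
    rw [comb]
    push_cast
    linear_combination ((d - c) * ζ₅ - d * ζ₅ ^ 3 : ℂ) * ζ₅_pow_five
  rw [h, im_fifth_root_comb]
  push_cast
  ring

/-- The product of the imaginary parts is a fixed multiple of the norm form of `ℤ[τ]`. -/
lemma im_product_eq (m n : ℝ) :
    (m * ζ₅.im + n * (ζ₅ ^ 2).im) * (m * (ζ₅ ^ 2).im - n * ζ₅.im) =
      ζ₅.im * (ζ₅ ^ 2).im * (m ^ 2 - m * n - n ^ 2) := by
  rw [ζ₅_sq_im]
  linear_combination m * n * ζ₅.im ^ 2 * ζ₅_re_quadratic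

/-- **Lemma.** There is a constant c > 0 such that every (λ, λ⋆) ∈ (1/25)ℒ with λ not
real satisfies |Im λ|·|Im λ⋆| ≥ c. -/
theorem im_product_lower_bound :
    ∃ c > 0, ∀ p : ℂ × ℂ, ((25 : ℂ) * p.1, (25 : ℂ) * p.2) ∈ PenLat → p.1.im ≠ 0 →
      c ≤ |p.1.im| * |p.2.im| := by
  have hpos : 0 < ζ₅.im * (ζ₅ ^ 2).im := by
    rw [ζ₅_sq_im]
    have := ζ₅_re_pos
    have := ζ₅_im_pos
    positivity
  refine ⟨ζ₅.im * (ζ₅ ^ 2).im / 625, by positivity, ?_⟩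
  rintro ⟨x, y⟩ ⟨a, b, c, d, hp⟩ hx
  obtain ⟨h₁, h₂⟩ := Prod.mk.inj hp
  have him (z : ℂ) : ((25 : ℂ) * z).im = 25 * z.im := by simp
  have hx_im := im_lattice_fst a b c d
  have hy_im := im_lattice_snd a b c d
  rw [← h₁, him] at hx_im
  rw [← h₂, him] at hy_im
  dsimp only at hx hx_im hy_im ⊢
  obtain ⟨m, hm⟩ : ∃ m : ℤ, m = b - a + d := ⟨_, rfl⟩
  obtain ⟨n, hn⟩ : ∃ n : ℤ, n = 2 * c - b - d := ⟨_, rfl⟩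
  have hm' : (b - a + d : ℝ) = m := by rw [hm]; push_cast; ring
  have hn' : (2 * c - b - d : ℝ) = n := by rw [hn]; push_cast; ring
  rw [hm', hn'] at hx_im hy_im
  have hmn : m ≠ 0 ∨ n ≠ 0 := by
    by_contra! h
    apply hx
    simpa [h.1, h.2] using hx_im
  have hform : (1 : ℝ) ≤ |(m : ℝ) ^ 2 - m * n - n ^ 2| := by
    exact_mod_cast Int.one_le_abs (golden_form_ne_zero hmn)
  have hprod : x.im * y.im =
      ζ₅.im * (ζ₅ ^ 2).im / 625 * ((m : ℝ) ^ 2 - m * n - n ^ 2) := by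
    have h := im_product_eq m n
    rw [← hx_im, ← hy_im] at h
    linear_combination h / 625
  rw [← abs_mul, hprod, abs_mul, abs_of_pos (by positivity)]
  exact le_mul_of_one_le_right (by positivity) hform

end
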